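/- Let S ⊂ ℝ^{n+1} be an (n+1)-dimensional simplex with inward normals n_v to the facets opposite each vertex v, and fix a vertex v_0. For each sign distribution φ : Vert(S) → {±1} with φ(v_0) = −1, let C_φ = {x : φ(v)·(n_v·x) ≥ 0 for all v}. Then the cones C_φ, as φ ranges over all sign distributions with φ(v_0) = −1 and φ surjective onto {±1}, cover the half-space H_{v_0}^− = {x : n_{v_0}·x ≤ 0}, and any two distinct such cones intersect only in a set of measure zero (they meet along the hyperplane arrangement ∪_v {x : n_v·x = 0}). -/

import Mathlib

open scoped RealInnerProductSpace

/-- In a full-dimensional real affine setting, every vector is a combination of affinely independent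
points whose number exceeds the dimension by one, with coefficients of sum zero. -/
theorem AffineIndependent.exists_sum_eq_zero_sum_smul_eq {ι V : Type*} [Fintype ι]
    [AddCommGroup V] [Module ℝ V] [FiniteDimensional ℝ V] {v : ι → V}
    (hv : AffineIndependent ℝ v) (hcard : Fintype.card ι = Module.finrank ℝ V + 1) (x : V) :
    ∃ c : ι → ℝ, ∑ i, c i = 0 ∧ ∑ i, c i • v i = x := by
  let b : AffineBasis ι ℝ V := ⟨v, hv, hv.affineSpan_eq_top_iff_card_eq_finrank_add_one.2 hcard⟩
  refine ⟨fun i => b.coord i x - b.coord i 0, ?_, ?_⟩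
  · simp [Finset.sum_sub_distrib]
  · have hx := b.linear_combination_coord_eq_self x
    have h0 := b.linear_combination_coord_eq_self 0
    change ∑ i, (b.coord i x - b.coord i 0) • b i = x
    simp [sub_smul, Finset.sum_sub_distrib, hx, h0]

/-- If the inner products of `u` with all points `v j`, `j ≠ i`, agree, then its inner product with
a combination of the `v j` with coefficients of sum zero only sees the `i`-th coefficient. -/
theorem inner_sum_smul_of_inner_sub_eq_zero {ι V : Type*} [Fintype ι] [NormedAddCommGroup V]
    [InnerProductSpace ℝ V] {v : ι → V} {u : V} {i k : ι} {c : ι → ℝ} (hc : ∑ j, c j = 0)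
    (hu : ∀ j, j ≠ i → ⟪u, v j - v k⟫ = 0) :
    ⟪u, ∑ j, c j • v j⟫ = c i * ⟪u, v i - v k⟫ := by
  have h : ∑ j, c j • v j = ∑ j, c j • (v j - v k) := by
    simp [smul_sub, Finset.sum_sub_distrib, ← Finset.sum_smul, hc]
  rw [h, inner_sum, Finset.sum_eq_single i]
  · rw [real_inner_smul_right]
  · intro j _ hj
    rw [real_inner_smul_right, hu j hj, mul_zero]
  · simp

/-- for a full-dimensional simplex `S ⊂ ℝ^{n+1}` with inward facet normals
`N i` and a fixed vertex `v 0`, the curvature cones `C_φ` over all sign distributions `φ`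
with `φ 0 = −1` taking both values cover the half-space `{x : ⟪N 0, x⟫ ≤ 0}`, and two
distinct such cones meet only along the hyperplane arrangement `⋃ i {x : ⟪N i, x⟫ = 0}`. -/
theorem curvature_cones_cover_halfspace {n : ℕ}
    (v : Fin (n + 2) → EuclideanSpace ℝ (Fin (n + 1)))
    (hv : AffineIndependent ℝ v)
    (N : Fin (n + 2) → EuclideanSpace ℝ (Fin (n + 1)))
    (hN0 : ∀ i, N i ≠ 0)
    (hNorth : ∀ i j k, j ≠ i → k ≠ i → ⟪N i, v j - v k⟫ = 0)
    (hNin : ∀ i j, j ≠ i → 0 < ⟪N i, v i - v j⟫) :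
    (∀ x : EuclideanSpace ℝ (Fin (n + 1)), ⟪N 0, x⟫ ≤ 0 →
      ∃ φ : Fin (n + 2) → ℝ, (∀ i, φ i = 1 ∨ φ i = -1) ∧ φ 0 = -1 ∧ (∃ i, φ i = 1) ∧
        ∀ i, 0 ≤ φ i * ⟪N i, x⟫) ∧
    (∀ φ ψ : Fin (n + 2) → ℝ,
      (∀ i, φ i = 1 ∨ φ i = -1) → φ 0 = -1 → (∃ i, φ i = 1) →
      (∀ i, ψ i = 1 ∨ ψ i = -1) → ψ 0 = -1 → (∃ i, ψ i = 1) →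
      φ ≠ ψ →
      ∀ x : EuclideanSpace ℝ (Fin (n + 1)),
        (∀ i, 0 ≤ φ i * ⟪N i, x⟫) → (∀ i, 0 ≤ ψ i * ⟪N i, x⟫) →
        ∃ i, ⟪N i, x⟫ = 0) := by
  refine ⟨fun x hx => ?_, fun φ ψ hφ _ _ hψ _ _ hne x hx hy => ?_⟩
  · have key : ∃ i, i ≠ 0 ∧ 0 ≤ ⟪N i, x⟫ := by
      by_contra! hneg
      obtain ⟨c, hc, rfl⟩ := hv.exists_sum_eq_zero_sum_smul_eq (by simp) x
      have hN : ∀ i k, k ≠ i → ⟪N i, ∑ j, c j • v j⟫ = c i * ⟪N i, v i - v k⟫ :=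
        fun i k hk => inner_sum_smul_of_inner_sub_eq_zero hc fun j hj => hNorth i j k hj hk
      have hc0 : c 0 ≤ 0 := by
        rw [hN 0 1 one_ne_zero] at hx
        exact nonpos_of_mul_nonpos_left hx (hNin 0 1 one_ne_zero)
      have hci : ∀ i, i ≠ 0 → c i < 0 := fun i hi => by
        have h := hneg i hi
        rw [hN i 0 hi.symm] at h
        exact neg_of_mul_neg_left h (hNin i 0 hi.symm).le
      refine (Finset.sum_neg' (s := Finset.univ) (f := c) (fun i _ => ?_)
        ⟨1, Finset.mem_univ _, hci 1 one_ne_zero⟩).ne hc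
      rcases eq_or_ne i 0 with rfl | hi
      exacts [hc0, (hci i hi).le]
    obtain ⟨k, hk, hkx⟩ := key
    refine ⟨fun i => if i ≠ 0 ∧ 0 ≤ ⟪N i, x⟫ then 1 else -1, fun i => ite_eq_or_eq _ _ _,
      by simp, ⟨k, by simp [hk, hkx]⟩, fun i => ?_⟩
    dsimp only
    split_ifs with h
    · simpa using h.2
    · rcases eq_or_ne i 0 with rfl | hi
      · linarith
      · have : ¬ 0 ≤ ⟪N i, x⟫ := fun h' => h ⟨hi, h'⟩
        linarith
  · obtain ⟨i, hi⟩ := Function.ne_iff.1 hne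
    refine ⟨i, ?_⟩
    have h1 := hx i
    have h2 := hy i
    rcases hφ i with h | h <;> rcases hψ i with h' | h' <;> rw [h] at h1 hi <;>
      rw [h'] at h2 hi <;> first | exact absurd rfl hi | linarith
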